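/- Let S be a weak system of quotients of a Lie triple system T over a field F and let I be an ideal of T with C_T(I) = 0. Then there is no nonzero x ∈ S such that [x,I,T] = 0 and [x,T,I] = 0. -/

import Mathlib

/-- A Lie triple system structure on an `F`-vector space `S`:
a trilinear map `b` satisfying `[x,x,z] = 0`, the cyclic identity and the
Leibniz (derivation) identity. -/
structure LTSStruct (F : Type*) (S : Type*) [Field F] [AddCommGroup S] [Module F S] where
  b : S → S → S → S
  add₁ : ∀ x x' y z, b (x + x') y z = b x y z + b x' y z
  smul₁ : ∀ (c : F) (x y z : S), b (c • x) y z = c • b x y z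
  add₂ : ∀ x y y' z, b x (y + y') z = b x y z + b x y' z
  smul₂ : ∀ (c : F) (x y z : S), b x (c • y) z = c • b x y z
  add₃ : ∀ x y z z', b x y (z + z') = b x y z + b x y z'
  smul₃ : ∀ (c : F) (x y z : S), b x y (c • z) = c • b x y z
  alt : ∀ x z, b x x z = 0
  cyclic : ∀ x y z, b x y z + b y z x + b z x y = 0
  leibniz : ∀ u v x y z,
    b u v (b x y z) = b (b u v x) y z + b x (b u v y) z + b x y (b u v z)

namespace LTSStruct

variable {F : Type*} [Field F] {S : Type*} [AddCommGroup S] [Module F S]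

/-- `I` is an ideal of the whole Lie triple system `S`: `[I,S,S] ⊆ I`. -/
def IsIdeal (L : LTSStruct F S) (I : Submodule F S) : Prop :=
  ∀ x ∈ I, ∀ y z : S, L.b x y z ∈ I

/-- `T` is a subsystem of `S`: `[T,T,T] ⊆ T`. -/
def IsSubsystem (L : LTSStruct F S) (T : Submodule F S) : Prop :=
  ∀ x ∈ T, ∀ y ∈ T, ∀ z ∈ T, L.b x y z ∈ T

/-- `I` is an ideal of the subsystem `T`: `I ⊆ T` and `[I,T,T] ⊆ I`. -/
def IsIdealOf (L : LTSStruct F S) (I T : Submodule F S) : Prop :=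
  I ≤ T ∧ ∀ x ∈ I, ∀ y ∈ T, ∀ z ∈ T, L.b x y z ∈ I

/-- The centralizer of a subset `I` in the whole system `S`:
`C_S(I) = {x ∈ S : [x,I,S] = [S,I,x] = 0}`. -/
def centralizer (L : LTSStruct F S) (I : Set S) : Set S :=
  {x | (∀ i ∈ I, ∀ t : S, L.b x i t = 0) ∧ (∀ t : S, ∀ i ∈ I, L.b t i x = 0)}

/-- The centralizer of a subset `I` in a subsystem `T`:
`C_T(I) = {x ∈ T : [x,I,T] = [T,I,x] = 0}`. -/
def relCentralizer (L : LTSStruct F S) (T : Submodule F S) (I : Set S) : Set S :=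
  {x | x ∈ T ∧ (∀ i ∈ I, ∀ t ∈ T, L.b x i t = 0) ∧ (∀ t ∈ T, ∀ i ∈ I, L.b t i x = 0)}

/-- The center `C(S) = {x ∈ S : [x,S,S] = 0}`. -/
def center (L : LTSStruct F S) : Set S := {x | ∀ y z : S, L.b x y z = 0}

/-- The center of a subsystem `T`: `C(T) = {x ∈ T : [x,T,T] = 0}`. -/
def relCenter (L : LTSStruct F S) (T : Submodule F S) : Set S :=
  {x | x ∈ T ∧ ∀ y ∈ T, ∀ z ∈ T, L.b x y z = 0}

/-- `S` is semiprime: `[S,I,I] ≠ 0` for every nonzero ideal `I`. -/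
def IsSemiprime (L : LTSStruct F S) : Prop :=
  ∀ I : Submodule F S, L.IsIdeal I → I ≠ ⊥ → ∃ t : S, ∃ i ∈ I, ∃ j ∈ I, L.b t i j ≠ 0

/-- `S` is prime: `[S,I,J] ≠ 0` for all nonzero ideals `I`, `J`. -/
def IsPrime (L : LTSStruct F S) : Prop :=
  ∀ I J : Submodule F S, L.IsIdeal I → L.IsIdeal J → I ≠ ⊥ → J ≠ ⊥ →
    ∃ t : S, ∃ i ∈ I, ∃ j ∈ J, L.b t i j ≠ 0

/-- `S` is nondegenerate: `[S,x,x] ≠ 0` for every nonzero `x`. -/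
def IsNondegenerate (L : LTSStruct F S) : Prop :=
  ∀ x : S, x ≠ 0 → ∃ t : S, L.b t x x ≠ 0

/-- A subsystem `T` is semiprime: `[T,I,I] ≠ 0` for every nonzero ideal `I` of `T`. -/
def RelSemiprime (L : LTSStruct F S) (T : Submodule F S) : Prop :=
  ∀ I : Submodule F S, L.IsIdealOf I T → I ≠ ⊥ → ∃ t ∈ T, ∃ i ∈ I, ∃ j ∈ I, L.b t i j ≠ 0

/-- A subsystem `T` is prime: `[T,I,J] ≠ 0` for all nonzero ideals `I`, `J` of `T`. -/
def RelPrime (L : LTSStruct F S) (T : Submodule F S) : Prop :=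
  ∀ I J : Submodule F S, L.IsIdealOf I T → L.IsIdealOf J T → I ≠ ⊥ → J ≠ ⊥ →
    ∃ t ∈ T, ∃ i ∈ I, ∃ j ∈ J, L.b t i j ≠ 0

/-- A subsystem `T` is nondegenerate: `[T,x,x] ≠ 0` for every nonzero `x ∈ T`. -/
def RelNondegenerate (L : LTSStruct F S) (T : Submodule F S) : Prop :=
  ∀ x ∈ T, x ≠ 0 → ∃ t ∈ T, L.b t x x ≠ 0

/-- An ideal `I` of `S` is essential if it hits every nonzero ideal of `S`. -/
def IsEssentialIdeal (L : LTSStruct F S) (I : Submodule F S) : Prop :=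
  L.IsIdeal I ∧ ∀ J : Submodule F S, L.IsIdeal J → J ≠ ⊥ → I ⊓ J ≠ ⊥

/-- An ideal `I` of the subsystem `T` is essential in `T` if it hits every
nonzero ideal of `T`. -/
def IsEssentialIdealOf (L : LTSStruct F S) (I T : Submodule F S) : Prop :=
  L.IsIdealOf I T ∧ ∀ J : Submodule F S, L.IsIdealOf J T → J ≠ ⊥ → I ⊓ J ≠ ⊥

/-- The elements `s`, `R(x₁,y₁)⋯R(xₙ,yₙ)(s)` with all `xᵢ, yᵢ ∈ T`, where
`R(x,y)(z) = [z,x,y]`. -/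
inductive InIter (L : LTSStruct F S) (T : Submodule F S) (s : S) : S → Prop
  | base : InIter L T s s
  | step (z x y : S) : InIter L T s z → x ∈ T → y ∈ T → InIter L T s (L.b z x y)

/-- `_T(s)`: the linear span in `S` of `s` and all `R(x₁,y₁)⋯R(xₙ,yₙ)(s)`,
`xᵢ, yᵢ ∈ T`. -/
def innerIdeal (L : LTSStruct F S) (T : Submodule F S) (s : S) : Submodule F S :=
  Submodule.span F {z | InIter L T s z}

/-- `(T:s) = {x ∈ T : [x,T,_T(s)] + [x,_T(s),T] ⊆ T}`. -/
def quotSet (L : LTSStruct F S) (T : Submodule F S) (s : S) : Set S :=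
  {x | x ∈ T ∧ ∀ t ∈ T, ∀ u ∈ L.innerIdeal T s, L.b x t u ∈ T ∧ L.b x u t ∈ T}

/-- `S` is a system of quotients of `T`. -/
def IsSystemOfQuotients (L : LTSStruct F S) (T : Submodule F S) : Prop :=
  L.IsSubsystem T ∧ ∀ s s' : S, s ≠ 0 →
    ∃ x ∈ T, ∃ y ∈ T, L.b s x y ≠ 0 ∧ (x ∈ L.quotSet T s' ∨ y ∈ L.quotSet T s')

/-- `S` is a weak system of quotients of `T`. -/
def IsWeakSystemOfQuotients (L : LTSStruct F S) (T : Submodule F S) : Prop :=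
  L.IsSubsystem T ∧ ∀ s : S, s ≠ 0 → ∃ x ∈ T, ∃ y ∈ T, L.b s x y ≠ 0 ∧ L.b s x y ∈ T

/-- `S` is ideally absorbed into `T`: for every `0 ≠ s ∈ S` there is an ideal `I`
of `T` with `C_T(I) = 0` and `0 ≠ [s,I,T] + [s,T,I] ⊆ T`. -/
def IsIdeallyAbsorbed (L : LTSStruct F S) (T : Submodule F S) : Prop :=
  L.IsSubsystem T ∧ ∀ s : S, s ≠ 0 → ∃ I : Submodule F S, L.IsIdealOf I T ∧
    L.relCentralizer T (I : Set S) = {0} ∧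
    (∃ i ∈ I, ∃ t ∈ T, L.b s i t ≠ 0 ∨ L.b s t i ≠ 0) ∧
    (∀ i ∈ I, ∀ t ∈ T, L.b s i t ∈ T ∧ L.b s t i ∈ T)

end LTSStruct

namespace LTSStruct

variable {F S : Type*} [Field F] [AddCommGroup S] [Module F S]

/-- A Lie triple product is skew-symmetric in its first two arguments. -/
theorem b_swap (L : LTSStruct F S) (x y z : S) : L.b x y z = -L.b y x z := by
  have h := L.alt (x + y) z
  rw [L.add₁, L.add₂, L.add₂, L.alt, L.alt, zero_add, add_zero] at h
  exact eq_neg_of_add_eq_zero_left h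

theorem b_zero_left (L : LTSStruct F S) (y z : S) : L.b 0 y z = 0 := by
  simpa using L.smul₁ 0 0 y z

theorem b_zero_mid (L : LTSStruct F S) (x z : S) : L.b x 0 z = 0 := by
  simpa using L.smul₂ 0 x 0 z

/-- The product of an element of an ideal in the middle slot stays in the ideal. -/
theorem IsIdealOf.b_mid_mem {L : LTSStruct F S} {I T : Submodule F S} (hI : L.IsIdealOf I T)
    {i t u : S} (hi : i ∈ I) (ht : t ∈ T) (hu : u ∈ T) : L.b t i u ∈ I := by
  rw [L.b_swap]
  exact I.neg_mem (hI.2 i hi t ht u hu)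

/-- If `[x,I,T] = [x,T,I] = 0`, then `[T,I,[x,T,T]] = 0`. -/
theorem IsIdealOf.b_b_eq_zero_of_annihilates {L : LTSStruct F S} {I T : Submodule F S}
    (hI : L.IsIdealOf I T) {x : S} (h₁ : ∀ i ∈ I, ∀ t ∈ T, L.b x i t = 0)
    (h₂ : ∀ t ∈ T, ∀ i ∈ I, L.b x t i = 0) {i t a c : S} (hi : i ∈ I) (ht : t ∈ T)
    (ha : a ∈ T) (hc : c ∈ T) : L.b t i (L.b x a c) = 0 := by
  have hx : L.b t i x = 0 := by
    simpa [L.b_swap i x t, h₁ i hi t ht, h₂ t ht i hi] using L.cyclic t i x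
  rw [L.leibniz, hx, L.b_zero_left, h₁ _ (hI.b_mid_mem hi ht ha) c hc,
    h₂ a ha _ (hI.b_mid_mem hi ht hc), add_zero, add_zero]

/-- If `x` satisfies `[x,I,T] = [x,T,I] = 0`, then every element of `[x,T,T] ∩ T`
centralizes `I`. -/
theorem IsIdealOf.b_mem_relCentralizer_of_annihilates {L : LTSStruct F S} {I T : Submodule F S}
    (hI : L.IsIdealOf I T) {x : S} (h₁ : ∀ i ∈ I, ∀ t ∈ T, L.b x i t = 0)
    (h₂ : ∀ t ∈ T, ∀ i ∈ I, L.b x t i = 0) {a c : S} (ha : a ∈ T) (hc : c ∈ T)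
    (hT : L.b x a c ∈ T) : L.b x a c ∈ L.relCentralizer T (I : Set S) := by
  refine ⟨hT, fun i hi t ht => ?_,
    fun t ht i hi => hI.b_b_eq_zero_of_annihilates h₁ h₂ hi ht ha hc⟩
  have h := L.leibniz x a c i t
  rw [h₂ a ha _ (hI.b_mid_mem hi hc ht), h₂ a ha i hi, L.b_zero_mid,
    hI.b_b_eq_zero_of_annihilates h₁ h₂ hi hc ha ht, add_zero, add_zero] at h
  exact h.symm

end LTSStruct

/-- if `S` is a weak system of quotients of `T` and `I` is an
ideal of `T` with `C_T(I) = 0`, then no nonzero `x ∈ S` satisfies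
`[x,I,T] = [x,T,I] = 0`. -/
theorem no_nonzero_annihilator_of_isWeakSystemOfQuotients
    {F S : Type*} [Field F] [AddCommGroup S] [Module F S]
    (L : LTSStruct F S) (T : Submodule F S) (h : L.IsWeakSystemOfQuotients T)
    (I : Submodule F S) (hI : L.IsIdealOf I T)
    (hC : L.relCentralizer T (I : Set S) = {0}) :
    ¬ ∃ x : S, x ≠ 0 ∧ (∀ i ∈ I, ∀ t ∈ T, L.b x i t = 0) ∧
      (∀ t ∈ T, ∀ i ∈ I, L.b x t i = 0) := by
  rintro ⟨x, hx, h₁, h₂⟩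
  obtain ⟨a, ha, c, hc, hne, hT⟩ := h.2 x hx
  have hmem := hI.b_mem_relCentralizer_of_annihilates h₁ h₂ ha hc hT
  rw [hC] at hmem
  exact hne hmem
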